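/- arXiv:1205.1933 — 2 statements merged into one kernel-verified Lean document; each statement's English description precedes it below -/
import Mathlib

section
/- Let F be a field of characteristic 0, A an n×n matrix over F, and A(n) the principal (n-1)×(n-1) submatrix obtained by deleting the n-th row and column. The standard basis vector e_n satisfies e_n^T p(A) e_n = (1/n) trace(p(A)) for all polynomials p if and only if the characteristic polynomial of A(n) equals (1/n) times the derivative of the characteristic polynomial of A. -/
open Matrix Polynomial

namespace Matrix

variable {ι R : Type*} [Fintype ι] [DecidableEq ι] [CommRing R]

/-- The derivative of a determinant, row by row. -/
theorem derivative_det (M : Matrix ι ι R[X]) :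
    derivative M.det = ∑ i, (M.updateRow i fun j => derivative (M i j)).det := by
  simp_rw [← det_transpose M, ← det_transpose (updateRow _ _ _), det_apply, derivative_sum]
  rw [Finset.sum_comm]
  refine Finset.sum_congr rfl fun σ _ => ?_
  rw [Units.smul_def, derivative_smul, derivative_prod_finset, ← Finset.smul_sum, ← Units.smul_def]
  congr 1
  refine Finset.sum_congr rfl fun i _ => ?_
  rw [← Finset.prod_erase_mul _ _ (Finset.mem_univ i)]
  congr 1
  · refine Finset.prod_congr rfl fun j hj => ?_
    simp [updateRow_ne (Finset.ne_of_mem_erase hj)]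
  · simp

theorem derivative_charpoly_eq_trace_adjugate (A : Matrix ι ι R) :
    derivative A.charpoly = (adjugate (charmatrix A)).trace := by
  rw [charpoly, derivative_det, trace]
  refine Finset.sum_congr rfl fun i _ => ?_
  rw [diag_apply, adjugate_apply]
  congr 2
  ext1 j
  obtain rfl | h := eq_or_ne i j
  · simp
  · simp [charmatrix_apply_ne _ _ _ h, Pi.single_eq_of_ne h.symm]

theorem charpoly_submatrix_castSucc {m : ℕ} (A : Matrix (Fin (m + 1)) (Fin (m + 1)) R) :
    (A.submatrix Fin.castSucc Fin.castSucc).charpoly =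
      adjugate (charmatrix A) (Fin.last m) (Fin.last m) := by
  rw [adjugate_fin_succ_eq_det_submatrix, ← two_mul, pow_mul, neg_one_sq, one_pow, one_mul,
    charpoly]
  congr 1
  ext1 i j
  simp [charmatrix_apply, diagonal_apply]

/-- The coefficients of the adjugate of `X - A`, as matrices over the base ring. -/
noncomputable def adjugateCoeff (A : Matrix ι ι R) (k : ℕ) : Matrix ι ι R :=
  (matPolyEquiv (adjugate (charmatrix A))).coeff k

theorem adjugateCoeff_apply (A : Matrix ι ι R) (k : ℕ) (i j : ι) :
    adjugateCoeff A k i j = (adjugate (charmatrix A) i j).coeff k :=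
  matPolyEquiv_coeff_apply _ _ _ _

theorem X_sub_C_mul_matPolyEquiv_adjugate (A : Matrix ι ι R) :
    (X - C A) * matPolyEquiv (adjugate (charmatrix A)) =
      A.charpoly.map (algebraMap R (Matrix ι ι R)) := by
  rw [← matPolyEquiv_charmatrix, ← map_mul, mul_adjugate, ← charpoly, matPolyEquiv_smul_one]

theorem adjugateCoeff_eq_mul_succ_add (A : Matrix ι ι R) (k : ℕ) :
    adjugateCoeff A k =
      A * adjugateCoeff A (k + 1) + algebraMap R _ (A.charpoly.coeff (k + 1)) := by
  have h := congrArg (coeff · (k + 1)) (X_sub_C_mul_matPolyEquiv_adjugate A)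
  simp only [sub_mul, coeff_sub, coeff_X_mul, coeff_C_mul, coeff_map] at h
  exact sub_eq_iff_eq_add'.mp h

theorem mul_adjugateCoeff_zero (A : Matrix ι ι R) :
    A * adjugateCoeff A 0 = -algebraMap R _ (A.charpoly.coeff 0) := by
  have h := congrArg (coeff · 0) (X_sub_C_mul_matPolyEquiv_adjugate A)
  simp only [sub_mul, coeff_sub, coeff_X_mul_zero, coeff_C_mul, coeff_map, zero_sub] at h
  exact neg_eq_iff_eq_neg.mp h

theorem exists_forall_ge_adjugateCoeff_eq_zero (A : Matrix ι ι R) :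
    ∃ N, ∀ k, N ≤ k → adjugateCoeff A k = 0 :=
  ⟨_, fun _ hk => coeff_eq_zero_of_natDegree_lt (Nat.lt_of_succ_le hk)⟩

theorem adjugateCoeff_mem_adjoin (A : Matrix ι ι R) (k : ℕ) :
    adjugateCoeff A k ∈ Algebra.adjoin R {A} := by
  obtain ⟨N, hN⟩ := exists_forall_ge_adjugateCoeff_eq_zero A
  obtain hk | hk := le_total N k
  · rw [hN k hk]
    exact zero_mem _
  · induction hk using Nat.decreasingInduction with
    | self => rw [hN N le_rfl]; exact zero_mem _
    | of_succ k _ ih =>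
      rw [adjugateCoeff_eq_mul_succ_add]
      exact add_mem (mul_mem (Algebra.self_mem_adjoin_singleton R A) ih)
        (Subalgebra.algebraMap_mem _ _)

theorem adjugateCoeff_eq_zero_of_card_le [Nontrivial R] (A : Matrix ι ι R) {k : ℕ}
    (hk : Fintype.card ι ≤ k) : adjugateCoeff A k = 0 := by
  obtain ⟨N, hN⟩ := exists_forall_ge_adjugateCoeff_eq_zero A
  obtain h | h := le_total N k
  · exact hN k h
  · induction h using Nat.decreasingInduction with
    | self => exact hN N le_rfl
    | of_succ k _ ih =>
      rw [adjugateCoeff_eq_mul_succ_add, ih (by lia), coeff_eq_zero_of_natDegree_lt, mul_zero,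
        map_zero, add_zero]
      rw [charpoly_natDegree_eq_dim]
      lia

theorem adjugateCoeff_card_sub_one [Nontrivial R] [Nonempty ι] (A : Matrix ι ι R) :
    adjugateCoeff A (Fintype.card ι - 1) = 1 := by
  have hc : Fintype.card ι - 1 + 1 = Fintype.card ι := Nat.sub_add_cancel Fintype.card_pos
  have h1 : A.charpoly.coeff (Fintype.card ι) = 1 := by
    have := A.charpoly_monic.coeff_natDegree
    rwa [charpoly_natDegree_eq_dim] at this
  rw [adjugateCoeff_eq_mul_succ_add, hc, adjugateCoeff_eq_zero_of_card_le A le_rfl, h1, mul_zero,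
    zero_add, map_one]

/-- A linear functional kills all polynomials in `A` iff it kills the coefficients of the adjugate
of `X - A`. -/
theorem forall_aeval_eq_zero_iff_forall_adjugateCoeff [Nontrivial R] [Nonempty ι]
    (A : Matrix ι ι R) (L : Matrix ι ι R →ₗ[R] R) :
    (∀ p : R[X], L (aeval A p) = 0) ↔ ∀ k, L (adjugateCoeff A k) = 0 := by
  refine ⟨fun h k => ?_, fun h p => ?_⟩
  · have hk := adjugateCoeff_mem_adjoin A k
    rw [Algebra.adjoin_singleton_eq_range_aeval] at hk
    obtain ⟨p, hp⟩ := hk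
    rw [← hp]
    exact h p
  · have key : ∀ j k, L (A ^ j * adjugateCoeff A k) = 0 := by
      intro j
      induction j with
      | zero => simpa using h
      | succ j ih =>
        have hj : L (A ^ j) = 0 := by
          simpa [adjugateCoeff_card_sub_one] using ih (Fintype.card ι - 1)
        intro k
        rw [pow_succ, mul_assoc]
        cases k with
        | zero =>
          rw [mul_adjugateCoeff_zero, mul_neg, Algebra.algebraMap_eq_smul_one, mul_smul_comm,
            mul_one, map_neg, map_smul, hj, smul_zero, neg_zero]
        | succ k =>
          rw [eq_sub_of_add_eq (adjugateCoeff_eq_mul_succ_add A k).symm, mul_sub, map_sub, ih,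
            Algebra.algebraMap_eq_smul_one, mul_smul_comm, mul_one, map_smul, hj, smul_zero,
            sub_zero]
    rw [aeval_eq_sum_range, map_sum]
    refine Finset.sum_eq_zero fun j _ => ?_
    have hj := key j (Fintype.card ι - 1)
    rw [adjugateCoeff_card_sub_one, mul_one] at hj
    rw [map_smul, hj, smul_zero]

end Matrix

theorem stmt2 (F : Type*) [Field F] [CharZero F] (m : ℕ)
    (A : Matrix (Fin (m + 1)) (Fin (m + 1)) F) :
    (∀ p : Polynomial F,
        (Polynomial.aeval A p) (Fin.last m) (Fin.last m)
          = ((m + 1 : ℕ) : F)⁻¹ * Matrix.trace (Polynomial.aeval A p)) ↔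
      Matrix.charpoly (A.submatrix Fin.castSucc Fin.castSucc)
        = Polynomial.C ((m + 1 : ℕ) : F)⁻¹ * Polynomial.derivative (Matrix.charpoly A) := by
  let L : Matrix (Fin (m + 1)) (Fin (m + 1)) F →ₗ[F] F :=
    entryLinearMap F F (Fin.last m) (Fin.last m) -
      ((m + 1 : ℕ) : F)⁻¹ • traceLinearMap (Fin (m + 1)) F F
  have hL (M) : L M = 0 ↔ M (Fin.last m) (Fin.last m) = ((m + 1 : ℕ) : F)⁻¹ * M.trace :=
    sub_eq_zero
  simp_rw [← hL]
  rw [forall_aeval_eq_zero_iff_forall_adjugateCoeff, charpoly_submatrix_castSucc,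
    derivative_charpoly_eq_trace_adjugate, Polynomial.ext_iff]
  simp_rw [hL, coeff_C_mul, trace, diag_apply, finsetSum_coeff, adjugateCoeff_apply]
end

section
/- Let t_1, t_2, … be elements of a commutative ℚ-algebra and define γ_1, γ_2, … recursively by the Newton-type identities j γ_j = t_j - ∑_{i=1}^{j-1} γ_i t_{j-i}. Then γ_m = ((-1)^{m-1}/m!) det T_m, where T_m is the m×m matrix with (i,1) entry t_i, (i,i+1) entry i for 1 ≤ i ≤ m-1, (i,j) entry t_{i-j+1} for j ≤ i, and zeros elsewhere. -/
open Matrix Polynomial PowerSeries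

/-- The structured matrix `X_n`: first column `(x_1,…,x_n)ᵀ`, superdiagonal `1,…,n-1`,
entry `x_{i-j+1}` for `j ≤ i` (1-based), zeros elsewhere. -/
def Xmat (R : Type*) [CommRing R] (n : ℕ) (x : ℕ → R) : Matrix (Fin n) (Fin n) R :=
  fun i j =>
    if (j : ℕ) ≤ (i : ℕ) then x ((i : ℕ) - (j : ℕ) + 1)
    else if (j : ℕ) = (i : ℕ) + 1 then (((i : ℕ) + 1 : ℕ) : R)
    else 0

/-- Deleting the first column and the last row of `Xmat` leaves a lower triangular matrix. -/
theorem det_Xmat_submatrix (R : Type*) [CommRing R] (n : ℕ) (x : ℕ → R) :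
    ((Xmat R (n + 1) x).submatrix (Fin.last n).succAbove (0 : Fin (n + 1)).succAbove).det
      = (n.factorial : R) := by
  rw [Matrix.det_of_isLowerTriangular]
  · simp only [Matrix.submatrix_apply, Xmat, Fin.succAbove_last, Fin.succAbove_zero,
      Fin.val_castSucc, Fin.val_succ]
    simp only [add_le_iff_nonpos_right, nonpos_iff_eq_zero, one_ne_zero, if_false, if_true]
    rw [Fin.prod_univ_eq_prod_range (fun i => ((i + 1 : ℕ) : R)) n, ← Nat.cast_prod,
      Finset.prod_range_add_one_eq_factorial]
  · intro i j hij
    have h : (i : ℕ) < j := hij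
    simp only [Matrix.submatrix_apply, Xmat, Fin.succAbove_last, Fin.succAbove_zero,
      Fin.val_castSucc, Fin.val_succ]
    rw [if_neg (by omega), if_neg (by omega)]

/-- The Newton-type recursion as a linear system with matrix `Xmat`. -/
theorem Xmat_mulVec_newton {R : Type*} [CommRing R] {t γ : ℕ → R}
    (hrec : ∀ j : ℕ, 1 ≤ j →
      (j : R) * γ j = t j - ∑ i ∈ Finset.Ico 1 j, γ i * t (j - i)) (n : ℕ) :
    Xmat R (n + 1) t *ᵥ Fin.cons 1 (fun k : Fin n => -γ (k + 1))
      = Pi.single (Fin.last n) (((n + 1 : ℕ) : R) * γ (n + 1)) := by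
  ext i
  have hi : (i : ℕ) ≤ n := Nat.lt_succ_iff.mp i.isLt
  have hr := hrec (i + 1) (by omega)
  rw [Finset.sum_Ico_eq_sum_range] at hr
  simp only [Matrix.mulVec, dotProduct, Fin.sum_univ_succ, Fin.cons_zero, Fin.cons_succ, Xmat,
    Fin.val_succ, Fin.val_zero, Nat.zero_le, if_true, mul_one, Nat.sub_zero]
  rw [Fin.sum_univ_eq_sum_range (fun k => (if k + 1 ≤ (i : ℕ) then t (i - (k + 1) + 1)
    else if k + 1 = (i : ℕ) + 1 then (((i : ℕ) + 1 : ℕ) : R) else 0) * -γ (k + 1)) n,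
    ← Finset.sum_range_add_sum_Ico _ hi]
  have hlow : ∑ k ∈ Finset.range i, (if k + 1 ≤ (i : ℕ) then t (i - (k + 1) + 1)
      else if k + 1 = (i : ℕ) + 1 then (((i : ℕ) + 1 : ℕ) : R) else 0) * -γ (k + 1)
      = -∑ k ∈ Finset.range (i + 1 - 1), γ (1 + k) * t (i + 1 - (1 + k)) := by
    rw [← Finset.sum_neg_distrib, Nat.add_sub_cancel]
    refine Finset.sum_congr rfl fun k hk => ?_
    have hk : k < i := Finset.mem_range.mp hk
    rw [if_pos (by omega), show (i : ℕ) - (k + 1) + 1 = i + 1 - (1 + k) by omega, add_comm k 1]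
    ring
  rw [hlow]
  rcases hi.eq_or_lt with h | h
  · obtain rfl : i = Fin.last n := Fin.ext h
    simp only [Fin.val_last] at hr ⊢
    simp only [Finset.Ico_self, Finset.sum_empty, Pi.single_eq_same, hr]
    ring
  · have hlast : i ≠ Fin.last n := fun hl => h.ne (congrArg Fin.val hl)
    rw [Pi.single_eq_of_ne hlast,
      Finset.sum_eq_single_of_mem (s := Finset.Ico (i : ℕ) n) (i : ℕ) (by simpa using h)]
    · rw [if_neg (by omega), if_pos rfl, mul_neg, hr]
      ring
    · intro k hk hne
      have := (Finset.mem_Ico.mp hk).1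
      rw [if_neg (by omega), if_neg (by omega), zero_mul]

theorem det_Xmat_of_newton {R : Type*} [CommRing R] {t γ : ℕ → R}
    (hrec : ∀ j : ℕ, 1 ≤ j →
      (j : R) * γ j = t j - ∑ i ∈ Finset.Ico 1 j, γ i * t (j - i)) (n : ℕ) :
    (Xmat R (n + 1) t).det = (-1) ^ n * ((n + 1).factorial : R) * γ (n + 1) := by
  have h := congrArg (fun w => ((Xmat R (n + 1) t).adjugate *ᵥ w) 0) (Xmat_mulVec_newton hrec n)
  simp only [Matrix.mulVec_mulVec, Matrix.adjugate_mul, Matrix.smul_mulVec, Matrix.one_mulVec,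
    Pi.smul_apply, Fin.cons_zero, smul_eq_mul, mul_one, Matrix.mulVec_single,
    Matrix.adjugate_fin_succ_eq_det_submatrix, det_Xmat_submatrix, Matrix.col_apply,
    MulOpposite.smul_eq_mul_unop, MulOpposite.unop_op, Fin.val_last, Fin.val_zero, add_zero] at h
  rw [h, Nat.factorial_succ]
  push_cast
  ring

theorem stmt18 (R : Type*) [CommRing R] [Algebra ℚ R] (t : ℕ → R) (γ : ℕ → R)
    (hrec : ∀ j : ℕ, 1 ≤ j →
      (j : R) * γ j = t j - ∑ i ∈ Finset.Ico 1 j, γ i * t (j - i))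
    (m : ℕ) (hm : 1 ≤ m) :
    γ m = (((-1 : ℚ) ^ (m - 1)) / (m.factorial : ℚ)) • Matrix.det (Xmat R m t) := by
  obtain ⟨n, rfl⟩ : ∃ n, m = n + 1 := ⟨m - 1, by omega⟩
  have hcast : (-1 : R) ^ n * ((n + 1).factorial : R) * γ (n + 1)
      = ((-1 : ℚ) ^ n * ((n + 1).factorial : ℚ)) • γ (n + 1) := by
    simp [Algebra.smul_def]
  have hne : ((n + 1).factorial : ℚ) ≠ 0 := by positivity
  rw [det_Xmat_of_newton hrec, hcast, smul_smul, Nat.add_sub_cancel,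
    show (-1 : ℚ) ^ n / ((n + 1).factorial : ℚ) * ((-1) ^ n * ((n + 1).factorial : ℚ)) = 1 by
      rw [div_mul_eq_mul_div, div_eq_one_iff_eq hne, ← mul_assoc, ← mul_pow]
      simp, one_smul]
end
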